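/- For the map F_λ with λ ∈ (1/2,1), setting α_m := −log(1−λ) and α_M := −log(λ(1−λ)), the Lyapunov spectrum α ↦ dim_H(J(α)) is real analytic on (α_m, α_M) but discontinuous at α_M: its one-sided limit as α → α_M⁻ equals (log 2 / log λ)·( log(λ/(1−λ)) / (−log(λ(1−λ))) − 1 ), which is strictly less than 1 = dim_H(J(α_M)). -/

import Mathlib

open Set Filter MeasureTheory Topology

noncomputable section

/-- The Birkhoff sum `S_n φ (x) = ∑_{i<n} φ(Tⁱ x)`. -/
def birk (T φ : ℝ → ℝ) (n : ℕ) (x : ℝ) : ℝ :=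
  ∑ i ∈ Finset.range n, φ (T^[i] x)

/-- The Markov partition of `(0,1]` for the map `F_λ`: `XF l 0 = (λ, 1)` is the paper's `X_1`
and `XF l n = (λ^{n+1}, λ^n)` is the paper's `X_{n+1}`. -/
def XF (l : ℝ) (n : ℕ) : Set ℝ := Set.Ioo (l ^ (n + 1)) (l ^ n)

-- The map `F_λ`: `x ↦ (x-λ)/(1-λ)` on `X_1 = (λ,1)` and
-- `x ↦ (x-λⁿ)/(λ(1-λ))` on `X_n = (λⁿ, λ^{n-1})` for `n ≥ 2`.
open scoped Classical in
def Fmap (l : ℝ) (x : ℝ) : ℝ :=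
  if x ∈ Set.Ioo l 1 then (x - l) / (1 - l)
  else if h : ∃ n : ℕ, x ∈ Set.Ioo (l ^ (n + 2)) (l ^ (n + 1)) then
    (x - l ^ (Nat.find h + 2)) / (l * (1 - l))
  else 0

/-- The absolute value of the derivative of `F_λ`: `1/(1-λ)` on `X_1` and
`1/(λ(1-λ))` on `X_n`, `n ≥ 2`. -/
def Fabsd (l : ℝ) (x : ℝ) : ℝ :=
  if x ∈ Set.Ioo l 1 then 1 / (1 - l) else 1 / (l * (1 - l))

/-- The domain `⋃ n, X_n` of `F_λ`. -/
def FdomainSet (l : ℝ) : Set ℝ := ⋃ n, XF l n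

/-- The repeller `X^∞` of `F_λ`: points whose whole forward orbit is defined. -/
def Frepeller (l : ℝ) : Set ℝ := {x | ∀ n : ℕ, (Fmap l)^[n] x ∈ FdomainSet l}

/-- The recurrent set `X_R` of `F_λ`. -/
def FrecSet (l : ℝ) : Set ℝ :=
  {x ∈ Frepeller l | ∃ m : ℕ, ∀ N : ℕ, ∃ n ≥ N, (Fmap l)^[n] x ∈ XF l m}

/-- The escaping set `Ω_λ` of points converging to `0` under iteration of `F_λ`. -/
def Fescape (l : ℝ) : Set ℝ :=
  {x ∈ Frepeller l | Filter.Tendsto (fun n : ℕ => (Fmap l)^[n] x) Filter.atTop (nhds 0)}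

/-- The level set `J_{φ,ψ}(α)` for quotients of Birkhoff averages of `F_λ`. -/
def FJset (l : ℝ) (φ ψ : ℝ → ℝ) (α : ℝ) : Set ℝ :=
  {x ∈ Frepeller l |
    Filter.Tendsto (fun n => birk (Fmap l) φ n x / birk (Fmap l) ψ n x)
      Filter.atTop (nhds α)}

/-- The restricted level set `J_{R,φ,ψ}(α) = J_{φ,ψ}(α) ∩ X_R`. -/
def FJR (l : ℝ) (φ ψ : ℝ → ℝ) (α : ℝ) : Set ℝ := FJset l φ ψ α ∩ FrecSet l

/-- The set of values of limits of quotients of Birkhoff averages on the repeller of `F_λ`. -/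
def FlimitSet (l : ℝ) (φ ψ : ℝ → ℝ) : Set ℝ :=
  {α | ∃ x ∈ Frepeller l,
    Filter.Tendsto (fun n => birk (Fmap l) φ n x / birk (Fmap l) ψ n x)
      Filter.atTop (nhds α)}

/-- The Birkhoff level set `J_{φ,1}(α) = {x : lim_n S_nφ(x)/n = α}`. -/
def FJB (l : ℝ) (φ : ℝ → ℝ) (α : ℝ) : Set ℝ :=
  {x ∈ Frepeller l |
    Filter.Tendsto (fun n => birk (Fmap l) φ n x / n) Filter.atTop (nhds α)}

/-- The set of Birkhoff averages attained as limits on the repeller of `F_λ`. -/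
def FlimB (l : ℝ) (φ : ℝ → ℝ) : Set ℝ :=
  {α | ∃ x ∈ Frepeller l,
    Filter.Tendsto (fun n => birk (Fmap l) φ n x / n) Filter.atTop (nhds α)}

/-- The Lyapunov level set
`J(α) = {x ∈ X^∞ : lim_n (1/n) log|(F_λⁿ)'(x)| = α}`. -/
def FJL (l : ℝ) (α : ℝ) : Set ℝ :=
  {x ∈ Frepeller l |
    Filter.Tendsto (fun n => birk (Fmap l) (fun y => Real.log (Fabsd l y)) n x / n)
      Filter.atTop (nhds α)}

/-- `φ : (0,1] → ℝ` is a Hölder potential. -/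
def HolderPotential (φ : ℝ → ℝ) : Prop :=
  ∃ C r : NNReal, 0 < r ∧ r ≤ 1 ∧ HolderOnWith C r φ (Set.Ioc 0 1)

/-- `F_λ`-invariant Borel probability measures supported on the repeller. -/
def FInvMeasure (l : ℝ) (μ : Measure ℝ) : Prop :=
  IsProbabilityMeasure μ ∧ μ (Frepeller l) = 1 ∧
    ∀ A : Set ℝ, MeasurableSet A → μ (Fmap l ⁻¹' A) = μ A

/-- A finite measurable partition of `ℝ`, with parts `P 0, …, P (k-1)`. -/
def IsFinPart (k : ℕ) (P : ℕ → Set ℝ) : Prop :=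
  (∀ i, MeasurableSet (P i)) ∧ (⋃ i ∈ Finset.range k, P i) = Set.univ ∧
    ∀ i j, i ≠ j → Disjoint (P i) (P j)

/-- The entropy `H_μ(⋁_{i<n} T^{-i} P)` of the `n`-th dynamical refinement of `P`. -/
def dynEnt (T : ℝ → ℝ) (μ : Measure ℝ) (k : ℕ) (P : ℕ → Set ℝ) (n : ℕ) : ℝ :=
  ∑ f : Fin n → Fin k,
    Real.negMulLog (μ (⋂ i : Fin n, T^[(i : ℕ)] ⁻¹' P (f i))).toReal

/-- Measure-theoretic (Kolmogorov–Sinai) entropy `h(μ)`. -/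
def entropy (T : ℝ → ℝ) (μ : Measure ℝ) : ℝ :=
  sSup {h | ∃ k : ℕ, ∃ P : ℕ → Set ℝ, IsFinPart k P ∧
    h = Filter.limsup (fun n => dynEnt T μ k P n / n) Filter.atTop}

/-- The Lyapunov exponent `λ_{F_λ}(μ) = ∫ log|F_λ'| dμ`. -/
def FlyapExp (l : ℝ) (μ : Measure ℝ) : ℝ := ∫ x, Real.log (Fabsd l x) ∂μ

/-- The one-sided shift on sequences. -/
def shiftMap (x : ℕ → ℕ) : ℕ → ℕ := fun i => x (i + 1)

/-- The shift space determined by a transition matrix `t` over the alphabet `ℕ`. -/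
def shiftSpace (t : ℕ → ℕ → Prop) : Set (ℕ → ℕ) := {x | ∀ i, t (x i) (x (i + 1))}

/-- Topological mixing of a countable Markov shift relative to a set `A` of symbols. -/
def TopMixingOn (t : ℕ → ℕ → Prop) (A : Set ℕ) : Prop :=
  ∀ a ∈ A, ∀ b ∈ A, ∃ N : ℕ, ∀ n ≥ N, n ≥ 1 → ∃ x ∈ shiftSpace t, x 0 = a ∧ x n = b

/-- A function on the shift space is locally Hölder: `var_n(g) ≤ C γⁿ` for all `n ≥ 1`. -/
def LocallyHolderOn (t : ℕ → ℕ → Prop) (g : (ℕ → ℕ) → ℝ) : Prop :=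
  ∃ C > (0 : ℝ), ∃ γ ∈ Set.Ioo (0 : ℝ) 1, ∀ n : ℕ, 1 ≤ n →
    ∀ x ∈ shiftSpace t, ∀ y ∈ shiftSpace t,
      (∀ i < n, x i = y i) → |g x - g y| ≤ C * γ ^ n

/-- A topologically mixing countable Markov coding `emb : Σ → X^∞` for `F_λ`. -/
def FCoding (l : ℝ) (t : ℕ → ℕ → Prop) (emb : (ℕ → ℕ) → ℝ) : Prop :=
  TopMixingOn t Set.univ ∧
  ContinuousOn emb (shiftSpace t) ∧
  Set.InjOn emb (shiftSpace t) ∧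
  emb '' shiftSpace t = Frepeller l ∧
  (∀ x ∈ shiftSpace t, Fmap l (emb x) = emb (shiftMap x)) ∧
  (∀ x ∈ shiftSpace t, emb x ∈ XF l (x 0))

/-! ### Binary coding of the unit interval

A binary word codes a nested sequence of intervals: `true` selects the left subinterval, of
proportion `a`, and `false` the right one, of proportion `1 - a`. -/

/-- The proportion of the subinterval selected by a symbol. -/
def bitWeight (a : ℝ) (b : Bool) : ℝ := if b then a else 1 - a

/-- The affine bijection of `[0,1]` onto the subinterval selected by a symbol. -/
def branch (a : ℝ) (b : Bool) (y : ℝ) : ℝ := if b then a * y else a + (1 - a) * y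

/-- The shift by `n` places on binary sequences. -/
def bitTail (ω : ℕ → Bool) (n : ℕ) : ℕ → Bool := fun i => ω (n + i)

/-- The length of the interval coded by the first `n` symbols. -/
def cylLen (a : ℝ) (ω : ℕ → Bool) (n : ℕ) : ℝ := ∏ i ∈ Finset.range n, bitWeight a (ω i)

/-- The left endpoint of the interval coded by the first `n` symbols. -/
def cylLeft (a : ℝ) (ω : ℕ → Bool) (n : ℕ) : ℝ :=
  ∑ i ∈ Finset.range n, if ω i then 0 else a * cylLen a ω i

/-- The point coded by a binary sequence. -/
def codePt (a : ℝ) (ω : ℕ → Bool) : ℝ := ∑' i, if ω i then 0 else a * cylLen a ω i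

/-- A sequence of points of `[0,1]` following the binary sequence `ω`. -/
def IsOrbit (a : ℝ) (ω : ℕ → Bool) (u : ℕ → ℝ) : Prop :=
  ∀ n, u n ∈ Icc (0 : ℝ) 1 ∧ u n = branch a (ω n) (u (n + 1))

/-- Both symbols occur infinitely often. -/
def BitBalanced (ω : ℕ → Bool) : Prop := ∀ b N, ∃ j, ω (N + j) = b

section Coding

variable {a : ℝ} {ω : ℕ → Bool}

lemma bitWeight_pos (ha : a ∈ Ioo (0 : ℝ) 1) (b : Bool) : 0 < bitWeight a b := by
  have := ha.1; have := ha.2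
  cases b <;> simp [bitWeight] <;> linarith

lemma bitWeight_le (b : Bool) : bitWeight a b ≤ max a (1 - a) := by
  cases b <;> simp [bitWeight]

lemma min_le_bitWeight (b : Bool) : min a (1 - a) ≤ bitWeight a b := by
  cases b <;> simp [bitWeight]

lemma max_lt_one (ha : a ∈ Ioo (0 : ℝ) 1) : max a (1 - a) < 1 :=
  max_lt ha.2 (by linarith [ha.1])

lemma cylLen_pos (ha : a ∈ Ioo (0 : ℝ) 1) (n : ℕ) : 0 < cylLen a ω n :=
  Finset.prod_pos fun _ _ => bitWeight_pos ha _

lemma cylLen_le_pow (ha : a ∈ Ioo (0 : ℝ) 1) (n : ℕ) : cylLen a ω n ≤ max a (1 - a) ^ n := by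
  simpa [cylLen] using Finset.prod_le_prod (s := Finset.range n)
    (fun i _ => (bitWeight_pos ha (ω i)).le) (fun i _ => bitWeight_le (ω i))

lemma pow_le_cylLen (ha : a ∈ Ioo (0 : ℝ) 1) (n : ℕ) : min a (1 - a) ^ n ≤ cylLen a ω n := by
  have h0 : 0 ≤ min a (1 - a) := le_min ha.1.le (by linarith [ha.2])
  simpa [cylLen] using Finset.prod_le_prod (s := Finset.range n)
    (fun i _ => h0) (fun i _ => min_le_bitWeight (a := a) (ω i))

lemma cylLen_le_one (ha : a ∈ Ioo (0 : ℝ) 1) (n : ℕ) : cylLen a ω n ≤ 1 :=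
  (cylLen_le_pow ha n).trans (pow_le_one₀ (ha.1.le.trans (le_max_left _ _)) (max_lt_one ha).le)

lemma tendsto_cylLen (ha : a ∈ Ioo (0 : ℝ) 1) : Tendsto (cylLen a ω) atTop (𝓝 0) :=
  squeeze_zero (fun n => (cylLen_pos ha n).le) (fun n => cylLen_le_pow ha n)
    (tendsto_pow_atTop_nhds_zero_of_lt_one (ha.1.le.trans (le_max_left _ _)) (max_lt_one ha))

lemma cylLen_add (m n : ℕ) : cylLen a ω (m + n) = cylLen a ω m * cylLen a (bitTail ω m) n :=
  Finset.prod_range_add _ _ _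

lemma cylLeft_succ (n : ℕ) :
    cylLeft a ω (n + 1) = cylLeft a ω n + if ω n then 0 else a * cylLen a ω n :=
  Finset.sum_range_succ _ _

lemma cylLen_succ (n : ℕ) : cylLen a ω (n + 1) = cylLen a ω n * bitWeight a (ω n) :=
  Finset.prod_range_succ _ _

lemma cylLeft_add_cylLen_le (ha : a ∈ Ioo (0 : ℝ) 1) (n : ℕ) :
    cylLeft a ω n + cylLen a ω n ≤ 1 := by
  induction n with
  | zero => simp [cylLeft, cylLen]
  | succ n ih =>
    have := cylLen_pos (ω := ω) ha n
    have h1 := ha.2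
    rw [cylLeft_succ, cylLen_succ]
    cases ω n <;> simp [bitWeight] <;> nlinarith

lemma hasSum_codePt (ha : a ∈ Ioo (0 : ℝ) 1) :
    HasSum (fun i => if ω i then 0 else a * cylLen a ω i) (codePt a ω) := by
  refine Summable.hasSum (summable_of_sum_range_le (c := 1) (fun n => ?_) fun n => ?_)
  · split_ifs
    · exact le_rfl
    · exact mul_nonneg ha.1.le (cylLen_pos ha n).le
  · exact (le_add_of_nonneg_right (cylLen_pos ha n).le).trans (cylLeft_add_cylLen_le ha n)

lemma codePt_mem_Icc (ha : a ∈ Ioo (0 : ℝ) 1) : codePt a ω ∈ Icc (0 : ℝ) 1 := by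
  have h := hasSum_codePt (ω := ω) ha
  constructor
  · refine h.nonneg fun n => ?_
    split_ifs
    · exact le_rfl
    · exact mul_nonneg ha.1.le (cylLen_pos ha n).le
  · refine le_of_tendsto' h.tendsto_sum_nat fun n => ?_
    exact (le_add_of_nonneg_right (cylLen_pos ha n).le).trans (cylLeft_add_cylLen_le ha n)

lemma codePt_eq_branch (ha : a ∈ Ioo (0 : ℝ) 1) :
    codePt a ω = branch a (ω 0) (codePt a (bitTail ω 1)) := by
  have h := (hasSum_codePt (ω := ω) ha).summable.tsum_eq_zero_add
  have h2 : ∀ i, (if ω (i + 1) then 0 else a * cylLen a ω (i + 1)) =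
      bitWeight a (ω 0) * if bitTail ω 1 i then 0 else a * cylLen a (bitTail ω 1) i := by
    intro i
    rw [add_comm i 1, cylLen_add]
    have h1 : cylLen a ω 1 = bitWeight a (ω 0) := by simp [cylLen]
    rw [h1]
    change (if ω (1 + i) then _ else _) = _ * if ω (1 + i) then _ else _
    split_ifs
    · simp
    · ring
  rw [tsum_congr h2, tsum_mul_left] at h
  change codePt a ω = _ + _ * codePt a (bitTail ω 1) at h
  rw [h]
  cases ω 0 <;> simp [branch, bitWeight, cylLen]

lemma bitTail_zero : bitTail ω 0 = ω := funext fun i => by simp [bitTail]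

lemma bitTail_tail (m n : ℕ) : bitTail (bitTail ω m) n = bitTail ω (m + n) :=
  funext fun i => by simp [bitTail, add_assoc]

lemma isOrbit_codePt (ha : a ∈ Ioo (0 : ℝ) 1) :
    IsOrbit a ω fun n => codePt a (bitTail ω n) := fun n =>
  ⟨codePt_mem_Icc ha, by
    have h := codePt_eq_branch (ω := bitTail ω n) ha
    rwa [bitTail_tail] at h⟩

lemma IsOrbit.eq_cyl {u : ℕ → ℝ} (hu : IsOrbit a ω u) (n : ℕ) :
    u 0 = cylLeft a ω n + cylLen a ω n * u n := by
  induction n with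
  | zero => simp [cylLeft, cylLen]
  | succ n ih =>
    rw [ih, (hu n).2, cylLeft_succ, cylLen_succ]
    cases ω n <;> simp [branch, bitWeight] <;> ring

lemma IsOrbit.eq_codePt {u : ℕ → ℝ} (ha : a ∈ Ioo (0 : ℝ) 1) (hu : IsOrbit a ω u) :
    u 0 = codePt a ω := by
  have h1 : Tendsto (fun n => cylLen a ω n * u n) atTop (𝓝 0) := by
    refine squeeze_zero (fun n => mul_nonneg (cylLen_pos ha n).le (hu n).1.1)
      (fun n => ?_) (tendsto_cylLen (ω := ω) ha)
    exact mul_le_of_le_one_right (cylLen_pos ha n).le (hu n).1.2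
  have h2 := (hasSum_codePt (ω := ω) ha).tendsto_sum_nat.add h1
  rw [add_zero] at h2
  refine tendsto_nhds_unique ?_ h2
  exact (tendsto_const_nhds (x := u 0)).congr fun n => hu.eq_cyl n

lemma codePt_eq_cyl (ha : a ∈ Ioo (0 : ℝ) 1) (n : ℕ) :
    codePt a ω = cylLeft a ω n + cylLen a ω n * codePt a (bitTail ω n) := by
  simpa only [bitTail_zero] using (isOrbit_codePt (ω := ω) ha).eq_cyl n

lemma BitBalanced.tail (h : BitBalanced ω) (n : ℕ) : BitBalanced (bitTail ω n) := fun b N => by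
  obtain ⟨j, hj⟩ := h b (n + N)
  exact ⟨j, by simpa [bitTail, add_assoc] using hj⟩

lemma exists_first (h : BitBalanced ω) (b : Bool) : ∃ j, ω j = b ∧ ∀ i < j, ω i = !b := by
  have hb : ∃ j, ω j = b := by simpa using h b 0
  refine ⟨Nat.find hb, Nat.find_spec hb, fun i hi => ?_⟩
  have := Nat.find_min hb hi
  revert this
  cases ω i <;> cases b <;> simp

lemma codePt_near_zero (h : BitBalanced ω) : ∃ j, ∀ a ∈ Ioo (0 : ℝ) 1,
    a * cylLen a ω j ≤ codePt a ω ∧ codePt a ω ≤ cylLen a ω j := by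
  obtain ⟨j, hj, hlt⟩ := exists_first h false
  refine ⟨j, fun a ha => ?_⟩
  have h0 : cylLeft a ω j = 0 := Finset.sum_eq_zero fun i hi => by
    simp [hlt i (Finset.mem_range.1 hi)]
  have h1 := (codePt_mem_Icc (ω := bitTail ω (j + 1)) ha).1
  have h2 := (codePt_mem_Icc (ω := bitTail ω j) ha).2
  have h3 := (isOrbit_codePt (ω := ω) ha j).2
  simp only [hj, branch, Bool.false_eq_true, if_false] at h3
  have h4 := cylLen_pos (ω := ω) ha j
  have h5 : a ≤ codePt a (bitTail ω j) := by
    rw [h3]; nlinarith [mul_nonneg (sub_nonneg.2 ha.2.le) h1]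
  rw [codePt_eq_cyl ha j, h0]
  constructor <;> nlinarith

lemma codePt_near_one (h : BitBalanced ω) : ∃ j, ∀ a ∈ Ioo (0 : ℝ) 1,
    (1 - a) * cylLen a ω j ≤ 1 - codePt a ω ∧ 1 - codePt a ω ≤ cylLen a ω j := by
  obtain ⟨j, hj, hlt⟩ := exists_first h true
  refine ⟨j, fun a ha => ?_⟩
  have h0 : ∀ i ≤ j, cylLeft a ω i + cylLen a ω i = 1 := by
    intro i
    induction i with
    | zero => simp [cylLeft, cylLen]
    | succ i ih =>
      intro hi
      rw [cylLeft_succ, cylLen_succ, hlt i (by omega), ← ih (by omega)]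
      simp [bitWeight]; ring
  have h0 := h0 j le_rfl
  have h1 := (codePt_mem_Icc (ω := bitTail ω (j + 1)) ha).2
  have h2 := (codePt_mem_Icc (ω := bitTail ω j) ha).1
  have h3 := (isOrbit_codePt (ω := ω) ha j).2
  simp only [hj, branch, if_true] at h3
  have h4 := cylLen_pos (ω := ω) ha j
  have h5 : codePt a (bitTail ω j) ≤ a := by
    rw [h3]; exact mul_le_of_le_one_right ha.1.le h1
  rw [codePt_eq_cyl ha j]
  constructor <;> nlinarith

lemma codePt_mem_Ioo (ha : a ∈ Ioo (0 : ℝ) 1) (h : BitBalanced ω) : codePt a ω ∈ Ioo (0 : ℝ) 1 := by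
  obtain ⟨j, hj⟩ := codePt_near_zero h
  obtain ⟨i, hi⟩ := codePt_near_one h
  have h1 := mul_pos ha.1 (cylLen_pos (ω := ω) ha j)
  have h2 := mul_pos (sub_pos.2 ha.2) (cylLen_pos (ω := ω) ha i)
  exact ⟨h1.trans_le (hj a ha).1, by linarith [(hi a ha).1]⟩

/-- Two coded points are separated, up to a factor, by the sum of the lengths of two intervals
coded by prefixes that do not depend on the parameter. -/
lemma codePt_sub_bounds {ω' : ℕ → Bool} (h : BitBalanced ω) (h' : BitBalanced ω') (hne : ω ≠ ω') :
    ∃ m n, ∀ a ∈ Ioo (0 : ℝ) 1,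
      min a (1 - a) * (cylLen a ω m + cylLen a ω' n) ≤ |codePt a ω - codePt a ω'| ∧
      |codePt a ω - codePt a ω'| ≤ cylLen a ω m + cylLen a ω' n := by
  have hd : ∃ N, ω N ≠ ω' N := Function.ne_iff.1 hne
  classical
  obtain ⟨N, hN, hlt⟩ : ∃ N, ω N ≠ ω' N ∧ ∀ i < N, ω i = ω' i :=
    ⟨Nat.find hd, Nat.find_spec hd, fun i hi => not_not.1 (Nat.find_min hd hi)⟩
  wlog hb : ω N = false generalizing ω ω' with H
  · have hb' : ω' N = false := by
      revert hN hb; cases ω N <;> cases ω' N <;> simp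
    obtain ⟨m, n, hmn⟩ := H h' h hne.symm (Function.ne_iff.1 hne.symm) hN.symm
      (fun i hi => (hlt i hi).symm) hb'
    refine ⟨n, m, fun a ha => ?_⟩
    rw [add_comm, abs_sub_comm]
    exact hmn a ha
  have hb' : ω' N = true := by revert hN hb; cases ω N <;> cases ω' N <;> simp
  obtain ⟨j, hj⟩ := codePt_near_zero (h.tail (N + 1))
  obtain ⟨i, hi⟩ := codePt_near_one (h'.tail (N + 1))
  refine ⟨N + 1 + j, N + 1 + i, fun a ha => ?_⟩
  have hlen : ∀ k ≤ N, cylLen a ω' k = cylLen a ω k := fun k hk =>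
    Finset.prod_congr rfl fun i hi => by rw [hlt i (by have := Finset.mem_range.1 hi; omega)]
  have hleft : cylLeft a ω' N = cylLeft a ω N := Finset.sum_congr rfl fun i hi => by
    have := Finset.mem_range.1 hi
    rw [hlt i this, hlen i (by omega)]
  have e1 := codePt_eq_cyl (ω := ω) ha (N + 1)
  have e2 := codePt_eq_cyl (ω := ω') ha (N + 1)
  rw [cylLeft_succ, cylLen_succ, hb] at e1
  rw [cylLeft_succ, cylLen_succ, hb', hleft, hlen N le_rfl] at e2
  rw [cylLen_add, cylLen_add (ω := ω'), cylLen_succ N, cylLen_succ N, hb, hb', hlen N le_rfl]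
  simp only [bitWeight, Bool.false_eq_true, if_true, if_false] at e1 e2 ⊢
  obtain ⟨p1, p2⟩ := hj a ha
  obtain ⟨q1, q2⟩ := hi a ha
  set L := cylLen a ω N
  have hL : 0 < L := cylLen_pos ha N
  set x := codePt a (bitTail ω (N + 1))
  set y := codePt a (bitTail ω' (N + 1))
  set X := cylLen a (bitTail ω (N + 1)) j
  set Y := cylLen a (bitTail ω' (N + 1)) i
  have hX : 0 < X := cylLen_pos ha j
  have hY : 0 < Y := cylLen_pos ha i
  have ha0 := ha.1
  have ha1 : 0 < 1 - a := sub_pos.2 ha.2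
  have ediff : codePt a ω - codePt a ω' = L * (1 - a) * x + L * a * (1 - y) := by
    rw [e1, e2]; ring
  have hx : 0 ≤ x := le_trans (by positivity) p1
  have hy : 0 ≤ 1 - y := le_trans (by positivity) q1
  rw [ediff, abs_of_nonneg (by positivity)]
  constructor
  · have c1 : min a (1 - a) * X ≤ x :=
      (mul_le_mul_of_nonneg_right (min_le_left _ _) hX.le).trans p1
    have c2 : min a (1 - a) * Y ≤ 1 - y :=
      (mul_le_mul_of_nonneg_right (min_le_right _ _) hY.le).trans q1
    calc _ = L * (1 - a) * (min a (1 - a) * X) + L * a * (min a (1 - a) * Y) := by ring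
      _ ≤ _ := by gcongr
  · gcongr

end Coding

/-! ### Comparison of dimensions for two parameters -/

lemma dimH_image_le_of_dist_le {ι : Type*} [Nonempty ι] {f g : ι → ℝ} {S : Set ι} {C r : NNReal}
    (hr : 0 < r) (h : ∀ x ∈ S, ∀ y ∈ S, |f x - f y| ≤ C * |g x - g y| ^ (r : ℝ)) :
    dimH (f '' S) ≤ dimH (g '' S) / r := by
  have hmem : ∀ x ∈ S, Function.invFunOn g S (g x) ∈ S := fun x hx =>
    Function.invFunOn_mem ⟨x, hx, rfl⟩
  have heq : ∀ x ∈ S, g (Function.invFunOn g S (g x)) = g x := fun x hx =>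
    Function.invFunOn_eq ⟨x, hx, rfl⟩
  have hF : HolderOnWith C r (f ∘ Function.invFunOn g S) (g '' S) := by
    rintro _ ⟨x, hx, rfl⟩ _ ⟨y, hy, rfl⟩
    have h1 := h _ (hmem x hx) _ (hmem y hy)
    rw [heq x hx, heq y hy] at h1
    rw [edist_dist, edist_dist, Real.dist_eq, Real.dist_eq,
      ENNReal.ofReal_rpow_of_nonneg (abs_nonneg _) r.coe_nonneg, ← ENNReal.ofReal_coe_nnreal,
      ← ENNReal.ofReal_mul C.coe_nonneg]
    exact ENNReal.ofReal_le_ofReal h1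
  have himg : f '' S = (f ∘ Function.invFunOn g S) '' (g '' S) := by
    rw [image_image]
    refine image_congr fun x hx => ?_
    have h1 := h x hx _ (hmem x hx)
    rw [heq x hx, sub_self, abs_zero, Real.zero_rpow (by exact_mod_cast hr.ne'), mul_zero] at h1
    exact sub_eq_zero.1 (abs_nonpos_iff.1 h1)
  rw [himg]
  exact hF.dimH_image_le hr

lemma dimH_codePt_image_le {a b : ℝ} (ha : a ∈ Ioo (0 : ℝ) 1) (hb : b ∈ Ioo (0 : ℝ) 1)
    {S : Set (ℕ → Bool)} (hS : ∀ ω ∈ S, BitBalanced ω) {C s : ℝ} (hs : 0 < s)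
    (h : ∀ ω ∈ S, ∀ n, cylLen b ω n ≤ C * cylLen a ω n ^ s) :
    dimH (codePt b '' S) ≤ dimH (codePt a '' S) / ENNReal.ofReal s := by
  have hm : 0 < min a (1 - a) := lt_min ha.1 (sub_pos.2 ha.2)
  set D : ℝ := max C 0 * (2 * (min a (1 - a))⁻¹ ^ s) with hD
  have hC0 : 0 ≤ max C 0 := le_max_right _ _
  have hD0 : 0 ≤ D := by positivity
  refine dimH_image_le_of_dist_le (C := ⟨D, hD0⟩) (r := s.toNNReal) (by simpa using hs) ?_
  intro x hx y hy
  rw [Real.coe_toNNReal s hs.le]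
  change _ ≤ D * _
  by_cases hxy : x = y
  · subst hxy
    simp [Real.zero_rpow hs.ne']
  obtain ⟨m, n, hmn⟩ := codePt_sub_bounds (hS x hx) (hS y hy) hxy
  have h1 := (hmn a ha).1
  have h2 := (hmn b hb).2
  have P : 0 < cylLen a x m := cylLen_pos ha m
  have Q : 0 < cylLen a y n := cylLen_pos ha n
  set d := |codePt a x - codePt a y|
  have key : ∀ z, 0 < z → z ≤ cylLen a x m + cylLen a y n →
      z ^ s ≤ (min a (1 - a))⁻¹ ^ s * d ^ s := by
    intro z hz hz'
    rw [← Real.mul_rpow (by positivity) (abs_nonneg _)]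
    refine Real.rpow_le_rpow hz.le ?_ hs.le
    rw [inv_mul_eq_div, le_div_iff₀ hm]
    nlinarith
  have k1 := key _ P (by linarith)
  have k2 := key _ Q (by linarith)
  have e1 := (h x hx m).trans (mul_le_mul_of_nonneg_right (le_max_left C 0) (by positivity))
  have e2 := (h y hy n).trans (mul_le_mul_of_nonneg_right (le_max_left C 0) (by positivity))
  calc _ ≤ _ := h2
    _ ≤ max C 0 * cylLen a x m ^ s + max C 0 * cylLen a y n ^ s := add_le_add e1 e2
    _ ≤ max C 0 * ((min a (1 - a))⁻¹ ^ s * d ^ s) + max C 0 * ((min a (1 - a))⁻¹ ^ s * d ^ s) := by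
      gcongr
    _ = D * d ^ s := by rw [hD]; ring

/-- The number of occurrences of the symbol `b` among the first `n` symbols. -/
def bitCount (b : Bool) (ω : ℕ → Bool) (n : ℕ) : ℕ := Nat.count (fun i => ω i = b) n

/-- The binary sequences in which `true` has frequency `g`. -/
def freqSet (g : ℝ) : Set (ℕ → Bool) :=
  {ω | Tendsto (fun n : ℕ => (bitCount true ω n : ℝ) / n) atTop (𝓝 g)}

lemma bitCount_succ (b : Bool) (ω : ℕ → Bool) (n : ℕ) :
    bitCount b ω (n + 1) = bitCount b ω n + if ω n = b then 1 else 0 := Nat.count_succ _ _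

lemma bitCount_add_bitCount (ω : ℕ → Bool) (n : ℕ) :
    bitCount true ω n + bitCount false ω n = n := by
  induction n with
  | zero => simp [bitCount]
  | succ n ih =>
    rw [bitCount_succ, bitCount_succ]
    cases ω n <;> simp <;> omega

lemma tendsto_bitCount_false {g : ℝ} {ω : ℕ → Bool} (h : ω ∈ freqSet g) :
    Tendsto (fun n : ℕ => (bitCount false ω n : ℝ) / n) atTop (𝓝 (1 - g)) := by
  refine (tendsto_const_nhds.sub h).congr' ?_
  filter_upwards [eventually_gt_atTop 0] with n hn
  have h1 : (bitCount true ω n : ℝ) + bitCount false ω n = n := by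
    exact_mod_cast bitCount_add_bitCount ω n
  have hn' : (n : ℝ) ≠ 0 := by positivity
  rw [eq_sub_of_add_eq h1]
  field_simp
  ring

lemma bitBalanced_of_tendsto {ω : ℕ → Bool} {g : Bool → ℝ} (hg : ∀ b, 0 < g b)
    (h : ∀ b, Tendsto (fun n : ℕ => (bitCount b ω n : ℝ) / n) atTop (𝓝 (g b))) :
    BitBalanced ω := by
  intro b N
  by_contra! hc
  have h1 : ∀ j, bitCount b ω (N + j) = bitCount b ω N := by
    intro j
    induction j with
    | zero => rfl
    | succ j ih => rw [← add_assoc, bitCount_succ, ih, if_neg (hc j), add_zero]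
  have h2 : Tendsto (fun n : ℕ => (bitCount b ω n : ℝ) / n) atTop (𝓝 0) := by
    refine Tendsto.congr' ?_ (tendsto_const_div_atTop_nhds_zero_nat (bitCount b ω N : ℝ))
    filter_upwards [eventually_ge_atTop N] with n hn
    obtain ⟨j, rfl⟩ := Nat.exists_eq_add_of_le hn
    rw [h1]
  exact (hg b).ne' (tendsto_nhds_unique (h b) h2)

lemma bitBalanced_of_mem_freqSet {g : ℝ} (hg : g ∈ Ioo (0 : ℝ) 1) {ω : ℕ → Bool}
    (h : ω ∈ freqSet g) : BitBalanced ω := by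
  refine bitBalanced_of_tendsto (g := fun b => bif b then g else 1 - g) ?_ ?_
  · rintro (_ | _)
    · exact sub_pos.2 hg.2
    · exact hg.1
  · rintro (_ | _)
    · exact tendsto_bitCount_false h
    · exact h

lemma log_cylLen {a : ℝ} (ha : a ∈ Ioo (0 : ℝ) 1) (ω : ℕ → Bool) (n : ℕ) :
    Real.log (cylLen a ω n) =
      bitCount true ω n * Real.log a + bitCount false ω n * Real.log (1 - a) := by
  induction n with
  | zero => simp [cylLen, bitCount]
  | succ n ih =>
    rw [cylLen_succ, Real.log_mul (cylLen_pos ha n).ne' (bitWeight_pos ha _).ne', ih,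
      bitCount_succ, bitCount_succ]
    cases ω n <;> simp [bitWeight] <;> ring

/-- The exponential decay rate of the coded intervals, when `true` has frequency `g`. -/
def cylRate (a g : ℝ) : ℝ := -(g * Real.log a + (1 - g) * Real.log (1 - a))

lemma cylRate_pos {a g : ℝ} (ha : a ∈ Ioo (0 : ℝ) 1) (hg : g ∈ Ioo (0 : ℝ) 1) :
    0 < cylRate a g := by
  have h1 := mul_neg_of_pos_of_neg hg.1 (Real.log_neg ha.1 ha.2)
  have h2 := mul_neg_of_pos_of_neg (sub_pos.2 hg.2)
    (Real.log_neg (sub_pos.2 ha.2) (by linarith [ha.1]))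
  unfold cylRate; linarith

lemma tendsto_log_cylLen {a g : ℝ} (ha : a ∈ Ioo (0 : ℝ) 1) {ω : ℕ → Bool} (h : ω ∈ freqSet g) :
    Tendsto (fun n : ℕ => Real.log (cylLen a ω n) / n) atTop (𝓝 (-cylRate a g)) := by
  have h1 := (Tendsto.mul_const (Real.log a) h).add
    ((tendsto_bitCount_false h).mul_const (Real.log (1 - a)))
  have h2 : -cylRate a g = g * Real.log a + (1 - g) * Real.log (1 - a) := by simp [cylRate]
  rw [h2]
  refine h1.congr fun n => ?_
  rw [log_cylLen ha]; ring

lemma dimH_codePt_freqSet_le {a b g s : ℝ} (ha : a ∈ Ioo (0 : ℝ) 1) (hb : b ∈ Ioo (0 : ℝ) 1)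
    (hg : g ∈ Ioo (0 : ℝ) 1) (hs : 0 < s) (hsr : s * cylRate a g < cylRate b g) :
    dimH (codePt b '' freqSet g) ≤ dimH (codePt a '' freqSet g) / ENNReal.ofReal s := by
  set T : ℕ → Set (ℕ → Bool) := fun M =>
    {ω ∈ freqSet g | ∀ n ≥ M, cylLen b ω n ≤ cylLen a ω n ^ s} with hT
  have hU : freqSet g = ⋃ M, T M := by
    refine Subset.antisymm (fun ω hω => ?_) (iUnion_subset fun M => sep_subset _ _)
    have h1 := ((tendsto_log_cylLen hb hω).sub ((tendsto_log_cylLen ha hω).const_mul s))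
    have h2 : -cylRate b g - s * -cylRate a g < 0 := by linarith
    obtain ⟨M, hM⟩ := eventually_atTop.1 ((h1.eventually_lt_const h2).and (eventually_gt_atTop 0))
    refine mem_iUnion.2 ⟨M, hω, fun n hn => ?_⟩
    obtain ⟨h3, h4⟩ := hM n hn
    have hn' : (0 : ℝ) < n := by exact_mod_cast h4
    rw [← mul_div_assoc, ← sub_div, div_lt_iff₀ hn', zero_mul] at h3
    rw [← Real.log_le_log_iff (cylLen_pos hb n) (Real.rpow_pos_of_pos (cylLen_pos ha n) s),
      Real.log_rpow (cylLen_pos ha n)]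
    linarith
  have hTle : ∀ M, dimH (codePt b '' T M) ≤ dimH (codePt a '' T M) / ENNReal.ofReal s := by
    intro M
    have hm : 0 < min a (1 - a) := lt_min ha.1 (sub_pos.2 ha.2)
    have hm1 : min a (1 - a) ≤ 1 := (min_le_left _ _).trans ha.2.le
    have hw : 0 < (min a (1 - a) ^ M) ^ s := by positivity
    have hw1 : (min a (1 - a) ^ M) ^ s ≤ 1 :=
      Real.rpow_le_one (by positivity) (pow_le_one₀ hm.le hm1) hs.le
    refine dimH_codePt_image_le ha hb (fun ω hω => bitBalanced_of_mem_freqSet hg hω.1) hs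
      (C := ((min a (1 - a) ^ M) ^ s)⁻¹) fun ω hω n => ?_
    have hp : 0 < cylLen a ω n ^ s := Real.rpow_pos_of_pos (cylLen_pos ha n) s
    rw [inv_mul_eq_div, le_div_iff₀ hw]
    rcases le_or_gt M n with hn | hn
    · calc _ ≤ cylLen b ω n * 1 := by gcongr; exact (cylLen_pos hb n).le
        _ ≤ _ := by rw [mul_one]; exact hω.2 n hn
    · calc _ ≤ 1 * (min a (1 - a) ^ M) ^ s := by gcongr; exact cylLen_le_one hb n
        _ ≤ _ := by
          rw [one_mul]
          refine Real.rpow_le_rpow (by positivity) ?_ hs.le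
          exact (pow_le_pow_of_le_one hm.le hm1 hn.le).trans (pow_le_cylLen ha n)
  conv_lhs => rw [hU, image_iUnion, dimH_iUnion]
  refine iSup_le fun M => (hTle M).trans ?_
  exact ENNReal.div_le_div_right (dimH_mono (image_mono (sep_subset _ _))) _

lemma toReal_dimH_codePt_freqSet_le {a b g : ℝ} (ha : a ∈ Ioo (0 : ℝ) 1)
    (hb : b ∈ Ioo (0 : ℝ) 1) (hg : g ∈ Ioo (0 : ℝ) 1) :
    (dimH (codePt b '' freqSet g)).toReal * cylRate b g ≤
      (dimH (codePt a '' freqSet g)).toReal * cylRate a g := by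
  have hA := cylRate_pos ha hg
  have hB := cylRate_pos hb hg
  have key : ∀ s ∈ Ioo (0 : ℝ) (cylRate b g / cylRate a g),
      (dimH (codePt b '' freqSet g)).toReal * s ≤ (dimH (codePt a '' freqSet g)).toReal := by
    intro s hs
    have h1 := dimH_codePt_freqSet_le ha hb hg hs.1 ((lt_div_iff₀ hA).1 hs.2)
    have hs0 : ENNReal.ofReal s ≠ 0 := by simpa using hs.1
    have h2 := ENNReal.toReal_mono
      (ENNReal.div_ne_top (Real.dimH_ne_top _) hs0) h1
    rwa [ENNReal.toReal_div, ENNReal.toReal_ofReal hs.1.le, le_div_iff₀ hs.1] at h2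
  have hlim : Tendsto (fun s => (dimH (codePt b '' freqSet g)).toReal * s)
      (𝓝[<] (cylRate b g / cylRate a g))
      (𝓝 ((dimH (codePt b '' freqSet g)).toReal * (cylRate b g / cylRate a g))) :=
    (tendsto_id.const_mul _).mono_left nhdsWithin_le_nhds
  have h3 := le_of_tendsto hlim (by
    filter_upwards [Ioo_mem_nhdsLT (div_pos hB hA)] with s hs using key s hs)
  rwa [← mul_div_assoc, div_le_iff₀ hA] at h3

/-! ### Almost every point has the expected frequency -/

/-- The full-branched map whose branches are the inverses of `branch a`. -/
def skewMap (a y : ℝ) : ℝ := if y < a then y / a else (y - a) / (1 - a)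

/-- The binary expansion of a point with respect to `skewMap a`. -/
def skewBits (a y : ℝ) : ℕ → Bool := fun n => decide ((skewMap a)^[n] y < a)

lemma measurable_skewMap (a : ℝ) : Measurable (skewMap a) :=
  Measurable.ite measurableSet_Iio (by fun_prop) (by fun_prop)

lemma branch_skewMap {a : ℝ} (ha : a ∈ Ioo (0 : ℝ) 1) (y : ℝ) :
    y = branch a (decide (y < a)) (skewMap a y) := by
  have := ha.1.ne'
  have := (sub_pos.2 ha.2).ne'
  by_cases h : y < a
  · simp only [branch, skewMap, h, decide_true, if_true]; field_simp
  · simp only [branch, skewMap, h, decide_false, if_false, Bool.false_eq_true]; field_simp; ring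

lemma skewMap_mem_Ico {a y : ℝ} (ha : a ∈ Ioo (0 : ℝ) 1) (hy : y ∈ Ico (0 : ℝ) 1) :
    skewMap a y ∈ Ico (0 : ℝ) 1 := by
  have h1 := sub_pos.2 ha.2
  have h0 := ha.1
  unfold skewMap
  split_ifs with h
  · exact ⟨div_nonneg hy.1 h0.le, (div_lt_one h0).2 h⟩
  · exact ⟨div_nonneg (by linarith) h1.le, (div_lt_one h1).2 (by linarith [hy.2])⟩

lemma isOrbit_skewMap {a y : ℝ} (ha : a ∈ Ioo (0 : ℝ) 1) (hy : y ∈ Ico (0 : ℝ) 1) :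
    IsOrbit a (skewBits a y) fun n => (skewMap a)^[n] y := by
  have hmem : ∀ n, (skewMap a)^[n] y ∈ Ico (0 : ℝ) 1 := fun n => by
    induction n with
    | zero => exact hy
    | succ n ih => rw [Function.iterate_succ_apply']; exact skewMap_mem_Ico ha ih
  refine fun n => ⟨Ico_subset_Icc_self (hmem n), ?_⟩
  simp only [Function.iterate_succ_apply']
  exact branch_skewMap ha _

lemma lintegral_Ico_affine {p q : ℝ} (hq : 0 < q) (f : ℝ → ENNReal) :
    ∫⁻ x in Ico p (p + q), f ((x - p) / q) = ENNReal.ofReal q * ∫⁻ x in Ico (0 : ℝ) 1, f x := by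
  have himg : Ico p (p + q) = (fun y => q * y + p) '' Ico (0 : ℝ) 1 := by
    ext x
    constructor
    · rintro ⟨h1, h2⟩
      refine ⟨(x - p) / q, ⟨div_nonneg (by linarith) hq.le, (div_lt_one hq).2 (by linarith)⟩, ?_⟩
      simp only
      field_simp
      ring
    · rintro ⟨y, ⟨h1, h2⟩, rfl⟩
      constructor <;> nlinarith
  rw [himg, lintegral_image_eq_lintegral_abs_deriv_mul measurableSet_Ico
    (f' := fun _ => q)
    (fun x _ => (by simpa using ((hasDerivAt_id x).const_mul q).add_const p :
      HasDerivAt (fun y => q * y + p) q x).hasDerivWithinAt)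
    (fun x _ y _ h => by simpa [hq.ne'] using h)]
  simp only [abs_of_pos hq, add_sub_cancel_right, mul_div_cancel_left₀ _ hq.ne']
  exact lintegral_const_mul' _ _ ENNReal.ofReal_ne_top

lemma lintegral_skewMap {a : ℝ} (ha : a ∈ Ioo (0 : ℝ) 1) (c₁ c₂ : ENNReal) (h₁ : c₁ ≠ ⊤)
    (h₂ : c₂ ≠ ⊤) (f : ℝ → ENNReal) :
    ∫⁻ y in Ico (0 : ℝ) 1, (if y < a then c₁ else c₂) * f (skewMap a y) =
      (ENNReal.ofReal a * c₁ + ENNReal.ofReal (1 - a) * c₂) * ∫⁻ y in Ico (0 : ℝ) 1, f y := by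
  have e1 : ∫⁻ y in Ico (0 : ℝ) a, (if y < a then c₁ else c₂) * f (skewMap a y) =
      c₁ * (ENNReal.ofReal a * ∫⁻ y in Ico (0 : ℝ) 1, f y) := by
    have h := lintegral_Ico_affine (p := 0) ha.1 f
    rw [← h, ← lintegral_const_mul' _ _ h₁, zero_add]
    refine setLIntegral_congr_fun measurableSet_Ico fun y hy => ?_
    simp [skewMap, hy.2]
  have e2 : ∫⁻ y in Ico a 1, (if y < a then c₁ else c₂) * f (skewMap a y) =
      c₂ * (ENNReal.ofReal (1 - a) * ∫⁻ y in Ico (0 : ℝ) 1, f y) := by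
    have h := lintegral_Ico_affine (p := a) (sub_pos.2 ha.2) f
    rw [← h, ← lintegral_const_mul' _ _ h₂, add_sub_cancel]
    refine setLIntegral_congr_fun measurableSet_Ico fun y hy => ?_
    simp [skewMap, not_lt.2 hy.1]
  rw [← Ico_union_Ico_eq_Ico ha.1.le ha.2.le, lintegral_union measurableSet_Ico
    (Ico_disjoint_Ico_same), e1, e2, Ico_union_Ico_eq_Ico ha.1.le ha.2.le]
  ring

lemma lintegral_prod_skewMap {a : ℝ} (ha : a ∈ Ioo (0 : ℝ) 1) (c₁ c₂ : ENNReal) (h₁ : c₁ ≠ ⊤)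
    (h₂ : c₂ ≠ ⊤) (n : ℕ) :
    ∫⁻ y in Ico (0 : ℝ) 1, ∏ i ∈ Finset.range n, (if (skewMap a)^[i] y < a then c₁ else c₂) =
      (ENNReal.ofReal a * c₁ + ENNReal.ofReal (1 - a) * c₂) ^ n := by
  induction n with
  | zero => simp
  | succ n ih =>
    rw [pow_succ', ← ih, ← lintegral_skewMap ha c₁ c₂ h₁ h₂]
    refine lintegral_congr fun y => ?_
    rw [Finset.prod_range_succ', mul_comm]
    simp only [Function.iterate_succ_apply, Function.iterate_zero, id_eq]
    rfl

/-- The centred number of visits of a `skewMap a`-orbit to the left branch. -/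
def skewDev (a : ℝ) (n : ℕ) (y : ℝ) : ℝ :=
  ∑ i ∈ Finset.range n, if (skewMap a)^[i] y < a then 1 - a else -a

lemma skewDev_eq (a : ℝ) (n : ℕ) (y : ℝ) :
    skewDev a n y = bitCount true (skewBits a y) n - a * n := by
  induction n with
  | zero => simp [skewDev, bitCount]
  | succ n ih =>
    rw [skewDev, Finset.sum_range_succ, ← skewDev, ih, bitCount_succ]
    by_cases h : (skewMap a)^[n] y < a <;> simp [skewBits, h] <;> ring

lemma exp_moment_le {a t : ℝ} (ha : a ∈ Ioo (0 : ℝ) 1) (ht : |t| ≤ 1) :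
    a * Real.exp (t * (1 - a)) + (1 - a) * Real.exp (t * -a) ≤ Real.exp (t ^ 2) := by
  have h0 := ha.1
  have h1 := sub_pos.2 ha.2
  have b1 : |t * (1 - a)| ≤ 1 := by
    rw [abs_mul, abs_of_pos h1]; nlinarith [abs_nonneg t]
  have b2 : |t * -a| ≤ 1 := by
    rw [abs_mul, abs_neg, abs_of_pos h0]; nlinarith [abs_nonneg t, ha.2]
  have e1 := (abs_le.1 (Real.abs_exp_sub_one_sub_id_le b1)).2
  have e2 := (abs_le.1 (Real.abs_exp_sub_one_sub_id_le b2)).2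
  have e3 := Real.add_one_le_exp (t ^ 2)
  have e4 := mul_le_mul_of_nonneg_left e1 h0.le
  have e5 := mul_le_mul_of_nonneg_left e2 h1.le
  have e6 : a * (t * (1 - a)) ^ 2 + (1 - a) * (t * -a) ^ 2 ≤ t ^ 2 := by
    have : a * (t * (1 - a)) ^ 2 + (1 - a) * (t * -a) ^ 2 = (a * (1 - a)) * t ^ 2 := by ring
    rw [this]
    have : a * (1 - a) ≤ 1 := by nlinarith
    nlinarith [sq_nonneg t]
  nlinarith

lemma measure_skewDev_le {a t : ℝ} (ha : a ∈ Ioo (0 : ℝ) 1) (ht : |t| ≤ 1) (n : ℕ) :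
    volume.restrict (Ico (0 : ℝ) 1) {y | 2 * t ^ 2 * n ≤ t * skewDev a n y} ≤
      ENNReal.ofReal (Real.exp (-t ^ 2) ^ n) := by
  set c₁ := ENNReal.ofReal (Real.exp (t * (1 - a)))
  set c₂ := ENNReal.ofReal (Real.exp (t * -a))
  have hm : Measurable fun y => ∏ i ∈ Finset.range n, (if (skewMap a)^[i] y < a then c₁ else c₂) :=
    Finset.measurable_prod _ fun i _ => Measurable.ite
      (measurableSet_lt ((measurable_skewMap a).iterate i) measurable_const)
      measurable_const measurable_const
  have hprod : ∀ y, ∏ i ∈ Finset.range n, (if (skewMap a)^[i] y < a then c₁ else c₂) =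
      ENNReal.ofReal (Real.exp (t * skewDev a n y)) := by
    intro y
    rw [skewDev, Finset.mul_sum, Real.exp_sum, ENNReal.ofReal_prod_of_nonneg
      fun _ _ => (Real.exp_pos _).le]
    refine Finset.prod_congr rfl fun i _ => ?_
    split_ifs <;> rfl
  have hmk := mul_meas_ge_le_lintegral₀ (μ := volume.restrict (Ico (0 : ℝ) 1)) hm.aemeasurable
    (ENNReal.ofReal (Real.exp (2 * t ^ 2 * n)))
  rw [lintegral_prod_skewMap ha c₁ c₂ ENNReal.ofReal_ne_top ENNReal.ofReal_ne_top] at hmk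
  have hset : {y | 2 * t ^ 2 * n ≤ t * skewDev a n y} = {y | ENNReal.ofReal
      (Real.exp (2 * t ^ 2 * n)) ≤
      ∏ i ∈ Finset.range n, (if (skewMap a)^[i] y < a then c₁ else c₂)} := by
    ext y
    rw [mem_ofPred_eq, mem_ofPred_eq, hprod, ENNReal.ofReal_le_ofReal_iff (Real.exp_pos _).le,
      Real.exp_le_exp]
  rw [hset]
  have hmom : ENNReal.ofReal a * c₁ + ENNReal.ofReal (1 - a) * c₂ ≤
      ENNReal.ofReal (Real.exp (t ^ 2)) := by
    rw [← ENNReal.ofReal_mul ha.1.le, ← ENNReal.ofReal_mul (sub_pos.2 ha.2).le,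
      ← ENNReal.ofReal_add (mul_pos ha.1 (Real.exp_pos _)).le
        (mul_pos (sub_pos.2 ha.2) (Real.exp_pos _)).le]
    exact ENNReal.ofReal_le_ofReal (exp_moment_le ha ht)
  have h1 := hmk.trans (pow_le_pow_left' hmom n)
  have hne : ENNReal.ofReal (Real.exp (2 * t ^ 2 * n)) ≠ 0 := by simp [Real.exp_pos]
  rw [mul_comm, ← ENNReal.le_div_iff_mul_le (Or.inl hne) (Or.inl ENNReal.ofReal_ne_top), ←
    ENNReal.ofReal_pow (Real.exp_pos _).le, ← ENNReal.ofReal_div_of_pos (Real.exp_pos _)] at h1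
  refine h1.trans (ENNReal.ofReal_le_ofReal (le_of_eq ?_))
  rw [← Real.exp_nat_mul, ← Real.exp_nat_mul, ← Real.exp_sub]
  ring_nf

lemma ae_eventually_skewDev {a t : ℝ} (ha : a ∈ Ioo (0 : ℝ) 1) (ht : |t| ≤ 1) (ht0 : t ≠ 0) :
    ∀ᵐ y ∂volume.restrict (Ico (0 : ℝ) 1), ∀ᶠ n : ℕ in atTop,
      t * skewDev a n y < 2 * t ^ 2 * n := by
  have hsum : ∑' n : ℕ, volume.restrict (Ico (0 : ℝ) 1)
      {y | 2 * t ^ 2 * n ≤ t * skewDev a n y} ≠ ⊤ := by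
    refine ne_top_of_le_ne_top ?_ (ENNReal.tsum_le_tsum fun n => measure_skewDev_le ha ht n)
    have hlt : Real.exp (-t ^ 2) < 1 := Real.exp_lt_one_iff.2 (by simpa using pow_pos (abs_pos.2 ht0) 2)
    rw [← ENNReal.ofReal_tsum_of_nonneg (fun n => by positivity)
      (summable_geometric_of_lt_one (Real.exp_pos _).le hlt)]
    exact ENNReal.ofReal_ne_top
  filter_upwards [ae_eventually_notMem hsum] with y hy
  filter_upwards [hy] with n hn
  simpa using hn

lemma ae_skewBits_mem_freqSet {a : ℝ} (ha : a ∈ Ioo (0 : ℝ) 1) :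
    ∀ᵐ y ∂volume.restrict (Ico (0 : ℝ) 1), skewBits a y ∈ freqSet a := by
  have ht : ∀ k : ℕ, |((k : ℝ) + 1)⁻¹| ≤ 1 := fun k => by
    rw [abs_of_pos (by positivity)]
    exact inv_le_one_of_one_le₀ (by linarith [(Nat.cast_nonneg k : (0 : ℝ) ≤ k)])
  have h1 := ae_all_iff.2 fun k : ℕ =>
    ae_eventually_skewDev ha (ht k) (by positivity)
  have h2 := ae_all_iff.2 fun k : ℕ =>
    ae_eventually_skewDev ha (t := -((k : ℝ) + 1)⁻¹) (by rw [abs_neg]; exact ht k)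
      (neg_ne_zero.2 (by positivity))
  filter_upwards [h1, h2] with y hy1 hy2
  refine Metric.tendsto_atTop.2 fun ε hε => ?_
  obtain ⟨k, hk⟩ := exists_nat_gt (2 / ε)
  have hk1 : 2 * ((k : ℝ) + 1)⁻¹ < ε := by
    rw [← div_eq_mul_inv, div_lt_iff₀ (by positivity)]
    rw [div_lt_iff₀ hε] at hk
    nlinarith
  obtain ⟨N, hN⟩ := eventually_atTop.1 (((hy1 k).and (hy2 k)).and (eventually_gt_atTop 0))
  refine ⟨N, fun n hn => ?_⟩
  obtain ⟨⟨h3, h4⟩, h5⟩ := hN n hn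
  have hn' : (0 : ℝ) < n := by exact_mod_cast h5
  set t : ℝ := ((k : ℝ) + 1)⁻¹
  have ht0 : 0 < t := by positivity
  have h6 : skewDev a n y < 2 * t * n := by nlinarith
  have h7 : -(2 * t * n) < skewDev a n y := by nlinarith
  have h8 : (bitCount true (skewBits a y) n : ℝ) / n - a = skewDev a n y / n := by
    rw [skewDev_eq]; field_simp
  rw [Real.dist_eq, h8, abs_div, abs_of_pos hn', div_lt_iff₀ hn']
  exact (abs_lt.2 ⟨h7, h6⟩).trans (by nlinarith)

lemma dimH_codePt_freqSet_self {a : ℝ} (ha : a ∈ Ioo (0 : ℝ) 1) :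
    dimH (codePt a '' freqSet a) = 1 := by
  refine le_antisymm ((dimH_mono (subset_univ _)).trans Real.dimH_univ.le) ?_
  have hsub : {y ∈ Ico (0 : ℝ) 1 | skewBits a y ∈ freqSet a} ⊆ codePt a '' freqSet a :=
    fun y hy => ⟨_, hy.2, ((isOrbit_skewMap ha hy.1).eq_codePt ha).symm⟩
  have h1 : volume (Ico (0 : ℝ) 1) ≤ volume {y ∈ Ico (0 : ℝ) 1 | skewBits a y ∈ freqSet a} := by
    refine measure_mono_ae ?_
    have h2 := (ae_restrict_iff' measurableSet_Ico).1 (ae_skewBits_mem_freqSet ha)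
    filter_upwards [h2] with y hy hy' using ⟨hy', hy hy'⟩
  have h3 : (1 : ENNReal) ≤ volume (codePt a '' freqSet a) := by
    simpa using h1.trans (measure_mono hsub)
  refine le_dimH_of_hausdorffMeasure_ne_zero (d := 1) ?_
  rw [NNReal.coe_one, hausdorffMeasure_real]
  exact (zero_lt_one.trans_le h3).ne'

lemma toReal_dimH_codePt_freqSet {a g : ℝ} (ha : a ∈ Ioo (0 : ℝ) 1) (hg : g ∈ Ioo (0 : ℝ) 1) :
    (dimH (codePt a '' freqSet g)).toReal = cylRate g g / cylRate a g := by
  have h1 := toReal_dimH_codePt_freqSet_le ha hg hg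
  have h2 := toReal_dimH_codePt_freqSet_le hg ha hg
  rw [dimH_codePt_freqSet_self hg, ENNReal.toReal_one, one_mul] at h1 h2
  rw [eq_div_iff (cylRate_pos ha hg).ne']
  exact le_antisymm h2 h1

/-! ### The queue driven by a binary sequence -/

/-- The length of the queue in which `true` is an arrival and `false` a service. -/
def queueLen (ω : ℕ → Bool) : ℕ → ℕ
  | 0 => 0
  | n + 1 => if ω n then queueLen ω n + 1 else queueLen ω n - 1

/-- The number of services of an empty queue. -/
def idleCount (ω : ℕ → Bool) : ℕ → ℕ
  | 0 => 0
  | n + 1 => if ω n = false ∧ queueLen ω n = 0 then idleCount ω n + 1 else idleCount ω n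

section Queue

variable {ω : ℕ → Bool}

lemma queueLen_add_bitCount (ω : ℕ → Bool) (n : ℕ) :
    queueLen ω n + bitCount false ω n = bitCount true ω n + idleCount ω n := by
  induction n with
  | zero => simp [queueLen, idleCount, bitCount]
  | succ n ih =>
    rw [bitCount_succ, bitCount_succ, queueLen, idleCount]
    cases ω n
    · by_cases h : queueLen ω n = 0 <;> simp [h] <;> omega
    · simp; omega

lemma exists_idleCount_eq (ω : ℕ → Bool) (n : ℕ) :
    ∃ j ≤ n, idleCount ω n + bitCount true ω j = bitCount false ω j := by
  induction n with
  | zero => exact ⟨0, le_rfl, by simp [idleCount, bitCount]⟩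
  | succ n ih =>
    by_cases h : ω n = false ∧ queueLen ω n = 0
    · refine ⟨n + 1, le_rfl, ?_⟩
      have := queueLen_add_bitCount ω n
      rw [bitCount_succ, bitCount_succ, idleCount, if_pos h, h.1]
      simp
      omega
    · obtain ⟨j, hj, h'⟩ := ih
      exact ⟨j, hj.trans n.le_succ, by rw [idleCount, if_neg h, h']⟩

lemma bitCount_mono (b : Bool) : Monotone (bitCount b ω) := Nat.count_monotone _

lemma exists_bitCount_add (h : BitBalanced ω) (b : Bool) (N k : ℕ) :
    ∃ j, bitCount b ω (N + j) = bitCount b ω N + k := by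
  induction k with
  | zero => exact ⟨0, rfl⟩
  | succ k ih =>
    obtain ⟨j, hj⟩ := ih
    obtain ⟨i, hi, hlt⟩ := exists_first (h.tail (N + j)) b
    have hc : ∀ m ≤ i, bitCount b ω (N + j + m) = bitCount b ω (N + j) := by
      intro m
      induction m with
      | zero => exact fun _ => rfl
      | succ m ihm =>
        intro hm
        have h1 : ω (N + j + m) = !b := hlt m (by omega)
        rw [← add_assoc, bitCount_succ, ihm (by omega), h1, if_neg (by simp), add_zero]
    have h2 : ω (N + j + i) = b := hi
    refine ⟨j + i + 1, ?_⟩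
    rw [← add_assoc, ← add_assoc, bitCount_succ, hc i le_rfl, if_pos h2, hj, add_assoc]

lemma bitCount_le (b : Bool) (n : ℕ) : bitCount b ω n ≤ n := Nat.count_le _

lemma tendsto_bitCount_atTop (h : BitBalanced ω) (b : Bool) :
    Tendsto (bitCount b ω) atTop atTop := by
  refine tendsto_atTop_atTop_of_monotone (bitCount_mono b) fun k => ?_
  obtain ⟨j, hj⟩ := exists_bitCount_add h b 0 k
  exact ⟨0 + j, by omega⟩

lemma tendsto_comp_bitCount_iff (h : BitBalanced ω) (b : Bool) {f : ℕ → ℝ} {F : Filter ℝ} :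
    Tendsto (fun n => f (bitCount b ω n)) atTop F ↔ Tendsto f atTop F := by
  refine ⟨fun hf => ?_, fun hf => hf.comp (tendsto_bitCount_atTop h b)⟩
  choose j hj using fun k => exists_bitCount_add h b 0 k
  have h0 : ∀ k, bitCount b ω (0 + j k) = k := fun k => by rw [hj]; simp [bitCount]
  have h1 : Tendsto (fun k => 0 + j k) atTop atTop :=
    tendsto_atTop_mono (fun k => (h0 k).symm.le.trans (bitCount_le b _)) tendsto_id
  exact (hf.comp h1).congr fun k => by simp only [Function.comp, h0]

lemma exists_false_of_bitCount_eq_succ {n N : ℕ} (h : bitCount false ω N = n + 1) :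
    ∃ m, ω m = false ∧ bitCount false ω m = n := by
  induction N with
  | zero => simp [bitCount] at h
  | succ N ih =>
    rw [bitCount_succ] at h
    by_cases hN : ω N = false
    · rw [if_pos hN] at h
      exact ⟨N, hN, by omega⟩
    · rw [if_neg hN] at h
      exact ih h

lemma idleCount_const (N j : ℕ)
    (h : bitCount false ω (N + j) ≤ bitCount false ω N + queueLen ω N) :
    idleCount ω (N + j) = idleCount ω N ∧
      queueLen ω N + bitCount false ω N ≤ queueLen ω (N + j) + bitCount false ω (N + j) := by
  induction j with
  | zero => simp
  | succ j ih =>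
    rw [← add_assoc, bitCount_succ] at h
    rw [← add_assoc, bitCount_succ, idleCount, queueLen]
    obtain ⟨h1, h2⟩ := ih (by omega)
    cases hb : ω (N + j)
    · rw [hb, if_pos rfl] at h
      have : queueLen ω (N + j) ≠ 0 := by omega
      simp [this, h1]
      omega
    · simp [h1]
      omega

lemma tendsto_idleCount_div {g : ℝ} (hg : g ∈ Ioo (0 : ℝ) 1) (h : ω ∈ freqSet g) :
    Tendsto (fun n : ℕ => (idleCount ω n : ℝ) / bitCount false ω n) atTop
      (𝓝 (max (1 - 2 * g) 0 / (1 - g))) := by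
  have hZ := tendsto_bitCount_false h
  have hD : Tendsto (fun n : ℕ => ((bitCount false ω n : ℝ) - bitCount true ω n) / n) atTop
      (𝓝 (1 - 2 * g)) := by
    have : (1 : ℝ) - 2 * g = 1 - g - g := by ring
    rw [this]
    exact (Tendsto.sub hZ h).congr fun n => by rw [sub_div]
  have hM : Tendsto (fun n : ℕ => (idleCount ω n : ℝ) / n) atTop (𝓝 (max (1 - 2 * g) 0)) := by
    refine tendsto_order.2 ⟨fun b hb => ?_, fun b hb => ?_⟩
    · rcases lt_max_iff.1 hb with hb | hb
      · filter_upwards [hD.eventually_const_lt hb] with n hn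
        refine hn.trans_le (div_le_div_of_nonneg_right ?_ n.cast_nonneg)
        have : (queueLen ω n : ℝ) + bitCount false ω n = bitCount true ω n + idleCount ω n := by
          exact_mod_cast queueLen_add_bitCount ω n
        linarith [(queueLen ω n).cast_nonneg (α := ℝ)]
      · exact Eventually.of_forall fun n => hb.trans_le (by positivity)
    · obtain ⟨c, hc1, hc2⟩ := exists_between hb
      have hc0 : 0 ≤ c := (le_max_right _ _).trans hc1.le
      obtain ⟨N, hN⟩ := eventually_atTop.1
        ((hD.eventually_lt_const ((le_max_left _ _).trans_lt hc1)).and (eventually_gt_atTop 0))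
      have hbound : ∀ n : ℕ, (idleCount ω n : ℝ) ≤ c * n + N := by
        intro n
        obtain ⟨j, hj, hj'⟩ := exists_idleCount_eq ω n
        have e : (idleCount ω n : ℝ) + bitCount true ω j = bitCount false ω j := by
          exact_mod_cast hj'
        have hjn : (j : ℝ) ≤ n := by exact_mod_cast hj
        rcases le_or_gt N j with h1 | h1
        · obtain ⟨h2, h3⟩ := hN j h1
          rw [div_lt_iff₀ (by exact_mod_cast h3)] at h2
          nlinarith [N.cast_nonneg (α := ℝ)]
        · have h2 : (bitCount false ω j : ℝ) ≤ j := by exact_mod_cast bitCount_le false j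
          have h3 : (j : ℝ) ≤ N := by exact_mod_cast h1.le
          have h4 : 0 ≤ c * n := by positivity
          linarith [(bitCount true ω j).cast_nonneg (α := ℝ)]
      have hlim : Tendsto (fun n : ℕ => c + (N : ℝ) / n) atTop (𝓝 c) := by
        simpa using tendsto_const_nhds.add (tendsto_const_div_atTop_nhds_zero_nat (N : ℝ))
      filter_upwards [hlim.eventually_lt_const hc2, eventually_gt_atTop 0] with n hn hn0
      have hn' : (0 : ℝ) < n := by exact_mod_cast hn0
      refine lt_of_le_of_lt ?_ hn
      rw [div_le_iff₀ hn', add_mul, div_mul_cancel₀ _ hn'.ne']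
      exact hbound n
  refine (hM.div hZ (sub_pos.2 hg.2).ne').congr' ?_
  filter_upwards [eventually_gt_atTop 0] with n hn
  have hn' : (n : ℝ) ≠ 0 := by positivity
  exact div_div_div_cancel_right₀ hn' _ _

lemma mem_freqSet_of_tendsto_idleCount {p : ℝ} (hp : p ∈ Ioo (0 : ℝ) 1) (hω : BitBalanced ω)
    (h : Tendsto (fun n : ℕ => (idleCount ω n : ℝ) / bitCount false ω n) atTop (𝓝 p)) :
    ω ∈ freqSet ((1 - p) / (2 - p)) := by
  choose j hj using fun N => exists_bitCount_add hω false N (queueLen ω N)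
  have h1 : Tendsto (fun N : ℕ => (idleCount ω N : ℝ) /
      ((bitCount false ω N : ℝ) + queueLen ω N)) atTop (𝓝 p) := by
    have ht : Tendsto (fun N => N + j N) atTop atTop :=
      tendsto_atTop_mono (fun N => Nat.le_add_right _ _) tendsto_id
    refine (h.comp ht).congr fun N => ?_
    simp only [Function.comp]
    rw [(idleCount_const N (j N) (hj N).le).1, hj]
    push_cast
    rfl
  have hZpos : ∀ᶠ N in atTop, 0 < bitCount false ω N :=
    (tendsto_bitCount_atTop hω false).eventually_gt_atTop 0
  have h2 : Tendsto (fun N : ℕ => (queueLen ω N : ℝ) / bitCount false ω N) atTop (𝓝 0) := by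
    have h3 := (h.div h1 hp.1.ne').sub_const 1
    rw [div_self hp.1.ne', sub_self] at h3
    refine h3.congr' ?_
    filter_upwards [hZpos, h.eventually_const_lt hp.1] with N hN hM
    have hZ' : (0 : ℝ) < bitCount false ω N := by exact_mod_cast hN
    have hM' : (0 : ℝ) < idleCount ω N := by
      rcases (idleCount ω N).cast_nonneg (α := ℝ) |>.lt_or_eq with h | h
      · exact h
      · rw [← h, zero_div] at hM
        exact absurd hM (lt_irrefl _)
    have : (bitCount false ω N : ℝ) + queueLen ω N ≠ 0 := by positivity
    simp only [Pi.div_apply]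
    field_simp
    ring
  have h4 : Tendsto (fun N : ℕ => (bitCount true ω N : ℝ) / bitCount false ω N) atTop
      (𝓝 (1 - p)) := by
    have h5 := (h2.add_const 1).sub h
    rw [zero_add] at h5
    refine h5.congr' ?_
    filter_upwards [hZpos] with N hN
    have hZ' : (bitCount false ω N : ℝ) ≠ 0 := by exact_mod_cast hN.ne'
    have : (queueLen ω N : ℝ) + bitCount false ω N = bitCount true ω N + idleCount ω N := by
      exact_mod_cast queueLen_add_bitCount ω N
    field_simp
    linarith
  have h6 := h4.div (h4.add_const 1) (by linarith [hp.2] : (0 : ℝ) < 1 - p + 1).ne'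
  rw [show (1 - p) / (1 - p + 1) = (1 - p) / (2 - p) by ring_nf] at h6
  refine h6.congr' ?_
  filter_upwards [hZpos] with N hN
  have hZ : (0 : ℝ) < bitCount false ω N := by exact_mod_cast hN
  have hsum : (bitCount true ω N : ℝ) + bitCount false ω N = N := by
    exact_mod_cast bitCount_add_bitCount ω N
  have hO : (0 : ℝ) ≤ bitCount true ω N := Nat.cast_nonneg _
  rw [Pi.div_apply, ← hsum]
  field_simp

end Queue

/-! ### The coding conjugates `Fmap` to a queue -/

section Dynamics

variable {l : ℝ}

lemma branch_false_mem_XF (hl : l ∈ Ioo (0 : ℝ) 1) {y : ℝ} (hy : y ∈ Ioo (0 : ℝ) 1) (k : ℕ) :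
    l ^ k * branch l false y ∈ XF l k := by
  have hk : 0 < l ^ k := pow_pos hl.1 k
  have h1 := sub_pos.2 hl.2
  have h2 := mul_pos h1 hy.1
  have h3 : l + (1 - l) * y < 1 := by nlinarith [mul_pos h1 (sub_pos.2 hy.2)]
  simp only [branch, Bool.false_eq_true, if_false, XF, pow_succ]
  constructor
  · exact mul_lt_mul_of_pos_left (by linarith) hk
  · exact mul_lt_of_lt_one_right hk h3

lemma XF_index_unique (hl : l ∈ Ioo (0 : ℝ) 1) {x : ℝ} {m n : ℕ} (hm : x ∈ XF l m)
    (hn : x ∈ XF l n) : m = n := by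
  have key : ∀ {m n : ℕ}, x ∈ XF l m → x ∈ XF l n → m ≤ n := fun hm hn => by
    have := (pow_lt_pow_iff_right_of_lt_one₀ hl.1 hl.2).1 (hn.1.trans hm.2)
    omega
  exact le_antisymm (key hm hn) (key hn hm)

lemma mem_Ioo_iff_of_mem_XF (hl : l ∈ Ioo (0 : ℝ) 1) {x : ℝ} {k : ℕ} (hx : x ∈ XF l k) :
    x ∈ Ioo l 1 ↔ k = 0 := by
  have h0 : XF l 0 = Ioo l 1 := by simp [XF]
  rw [← h0]
  exact ⟨fun h => XF_index_unique hl hx h, fun h => h ▸ hx⟩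

lemma Fmap_branch_false (hl : l ∈ Ioo (0 : ℝ) 1) {y : ℝ} (hy : y ∈ Ioo (0 : ℝ) 1) (k : ℕ) :
    Fmap l (l ^ k * branch l false y) = l ^ (k - 1) * y := by
  have hx := branch_false_mem_XF hl hy k
  have h1 := (sub_pos.2 hl.2).ne'
  have h0 := hl.1.ne'
  simp only [Fmap, mem_Ioo_iff_of_mem_XF hl hx]
  rcases k with _ | k
  · simp [branch, h1]
  · rw [if_neg (Nat.succ_ne_zero k)]
    have hex : ∃ n : ℕ, l ^ (k + 1) * branch l false y ∈ Ioo (l ^ (n + 2)) (l ^ (n + 1)) := ⟨k, hx⟩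
    rw [dif_pos hex]
    have hfind := Nat.succ_injective (XF_index_unique (m := Nat.find hex + 1) (n := k + 1) hl
      (Nat.find_spec hex) hx)
    rw [hfind]
    simp only [branch, Bool.false_eq_true, if_false, Nat.add_sub_cancel]
    field_simp
    ring

lemma log_Fabsd_of_mem_XF (hl : l ∈ Ioo (0 : ℝ) 1) {x : ℝ} {k : ℕ} (hx : x ∈ XF l k) :
    Real.log (Fabsd l x) = -Real.log (l * (1 - l)) + if k = 0 then Real.log l else 0 := by
  have h1 := (sub_pos.2 hl.2).ne'
  simp only [Fabsd, mem_Ioo_iff_of_mem_XF hl hx]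
  split_ifs
  · rw [one_div, Real.log_inv, Real.log_mul hl.1.ne' h1]; ring
  · rw [one_div, Real.log_inv, add_zero]

lemma Fmap_iterate_bitCount_succ (hl : l ∈ Ioo (0 : ℝ) 1) {ω : ℕ → Bool} {x y z : ℝ} {N : ℕ}
    (h : (Fmap l)^[bitCount false ω N] x = l ^ queueLen ω N * y) (hy : y = branch l (ω N) z)
    (hz : z ∈ Ioo (0 : ℝ) 1) :
    (Fmap l)^[bitCount false ω (N + 1)] x = l ^ queueLen ω (N + 1) * z := by
  rw [bitCount_succ, queueLen]
  cases hb : ω N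
  · rw [hb] at hy
    rw [if_pos rfl, Function.iterate_succ_apply', h, hy, Fmap_branch_false hl hz]
    simp
  · rw [hb] at hy
    simp only [reduceCtorEq, if_false, add_zero, if_true]
    rw [h, hy]
    simp only [branch, if_true]
    ring

lemma Fmap_iterate_bitCount (hl : l ∈ Ioo (0 : ℝ) 1) {ω : ℕ → Bool} {u : ℕ → ℝ}
    (hu : IsOrbit l ω u) (hpos : ∀ n, u n ∈ Ioo (0 : ℝ) 1) (N : ℕ) :
    (Fmap l)^[bitCount false ω N] (u 0) = l ^ queueLen ω N * u N := by
  induction N with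
  | zero => simp [bitCount, queueLen]
  | succ N ih => exact Fmap_iterate_bitCount_succ hl ih (hu N).2 (hpos _)

lemma Fmap_iterate_mem_XF (hl : l ∈ Ioo (0 : ℝ) 1) {ω : ℕ → Bool} {u : ℕ → ℝ}
    (hu : IsOrbit l ω u) (hpos : ∀ n, u n ∈ Ioo (0 : ℝ) 1) {N : ℕ} (hN : ω N = false) :
    (Fmap l)^[bitCount false ω N] (u 0) ∈ XF l (queueLen ω N) := by
  rw [Fmap_iterate_bitCount hl hu hpos, (hu N).2, hN]
  exact branch_false_mem_XF hl (hpos _) _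

lemma birk_log_Fabsd (hl : l ∈ Ioo (0 : ℝ) 1) {ω : ℕ → Bool} {u : ℕ → ℝ}
    (hu : IsOrbit l ω u) (hpos : ∀ n, u n ∈ Ioo (0 : ℝ) 1) (N : ℕ) :
    birk (Fmap l) (fun y => Real.log (Fabsd l y)) (bitCount false ω N) (u 0) =
      -Real.log (l * (1 - l)) * bitCount false ω N + Real.log l * idleCount ω N := by
  induction N with
  | zero => simp [bitCount, idleCount, birk]
  | succ N ih =>
    rw [bitCount_succ, idleCount]
    cases hb : ω N
    · rw [birk] at ih ⊢
      rw [if_pos rfl, Finset.sum_range_succ, ih, log_Fabsd_of_mem_XF hl (Fmap_iterate_mem_XF hl hu hpos hb)]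
      by_cases hq : queueLen ω N = 0
      · simp [hq]; ring
      · simp [hq]; ring
    · simpa using ih

lemma codePt_mem_Frepeller (hl : l ∈ Ioo (0 : ℝ) 1) {ω : ℕ → Bool} (h : BitBalanced ω) :
    codePt l ω ∈ Frepeller l := by
  intro n
  obtain ⟨j, hj⟩ := exists_bitCount_add h false 0 (n + 1)
  obtain ⟨m, hm, hmn⟩ := exists_false_of_bitCount_eq_succ (n := n) (hj.trans (by simp [bitCount]))
  have := Fmap_iterate_mem_XF hl (isOrbit_codePt (ω := ω) hl)
    (fun N => codePt_mem_Ioo hl (h.tail N)) hm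
  rw [bitTail_zero, hmn] at this
  exact mem_iUnion.2 ⟨_, this⟩

lemma skewMap_iterate_mem_Ioo (hl : l ∈ Ioo (0 : ℝ) 1) {x : ℝ} (hx : x ∈ Frepeller l) (N : ℕ) :
    (skewMap l)^[N] x ∈ Ioo (0 : ℝ) 1 := by
  have hx0 : x ∈ Ioo (0 : ℝ) 1 := by
    obtain ⟨k, hk⟩ := mem_iUnion.1 (hx 0)
    exact ⟨(pow_pos hl.1 _).trans hk.1, hk.2.trans_le (pow_le_one₀ hl.1.le hl.2.le)⟩
  have hu := isOrbit_skewMap hl (Ioo_subset_Ico_self hx0)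
  suffices h : (skewMap l)^[N] x ∈ Ioo (0 : ℝ) 1 ∧
      (Fmap l)^[bitCount false (skewBits l x) N] x =
        l ^ queueLen (skewBits l x) N * (skewMap l)^[N] x from h.1
  induction N with
  | zero => simpa [bitCount, queueLen] using hx0
  | succ N ih =>
    obtain ⟨h1, h2⟩ := ih
    have h3 := (hu N).2
    suffices h4 : (skewMap l)^[N + 1] x ∈ Ioo (0 : ℝ) 1 from
      ⟨h4, Fmap_iterate_bitCount_succ hl h2 h3 h4⟩
    have h5 : (skewMap l)^[N + 1] x ∈ Ico (0 : ℝ) 1 := by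
      rw [Function.iterate_succ_apply']
      exact skewMap_mem_Ico hl (Ioo_subset_Ico_self h1)
    refine ⟨h5.1.lt_of_ne fun h0 => ?_, h5.2⟩
    simp only [← h0] at h3
    cases hb : skewBits l x N
    · rw [hb] at h3
      simp only [branch, Bool.false_eq_true, if_false, mul_zero, add_zero] at h3
      obtain ⟨k, hk⟩ := mem_iUnion.1 (hx (bitCount false (skewBits l x) N))
      rw [h2, h3, ← pow_succ] at hk
      have a1 := (pow_lt_pow_iff_right_of_lt_one₀ hl.1 hl.2).1 hk.1
      have a2 := (pow_lt_pow_iff_right_of_lt_one₀ hl.1 hl.2).1 hk.2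
      omega
    · rw [hb] at h3
      simp only [branch, if_true, mul_zero] at h3
      exact h1.1.ne' h3

lemma bitBalanced_of_isOrbit (hl : l ∈ Ioo (0 : ℝ) 1) {ω : ℕ → Bool} {u : ℕ → ℝ}
    (hu : IsOrbit l ω u) (hpos : ∀ n, u n ∈ Ioo (0 : ℝ) 1) : BitBalanced ω := by
  intro b N
  by_contra! hc
  have h1 : u N = codePt l (bitTail ω N) :=
    IsOrbit.eq_codePt (u := fun n => u (N + n)) hl fun n => hu (N + n)
  cases b
  · have h2 : IsOrbit l (bitTail ω N) fun _ => 0 := fun n =>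
      ⟨by simp, by simp [bitTail, branch, Bool.eq_true_of_not_eq_false (hc n)]⟩
    exact (hpos N).1.ne (h2.eq_codePt hl |>.trans h1.symm)
  · have h2 : IsOrbit l (bitTail ω N) fun _ => 1 := fun n =>
      ⟨by simp, by simp [bitTail, branch, Bool.eq_false_of_not_eq_true (hc n)]⟩
    exact (hpos N).2.ne' (h2.eq_codePt hl |>.trans h1.symm)

lemma Frepeller_eq_image (hl : l ∈ Ioo (0 : ℝ) 1) :
    Frepeller l = codePt l '' {ω | BitBalanced ω} := by
  ext x
  constructor
  · intro hx
    have hpos := skewMap_iterate_mem_Ioo hl hx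
    have hu := isOrbit_skewMap hl (Ioo_subset_Ico_self (hpos 0))
    exact ⟨skewBits l x, bitBalanced_of_isOrbit hl hu hpos, (hu.eq_codePt hl).symm⟩
  · rintro ⟨ω, hω, rfl⟩
    exact codePt_mem_Frepeller hl hω

lemma codePt_mem_FJL_iff (hl : l ∈ Ioo (0 : ℝ) 1) {ω : ℕ → Bool} (h : BitBalanced ω) (α : ℝ) :
    codePt l ω ∈ FJL l α ↔
      Tendsto (fun n : ℕ => (idleCount ω n : ℝ) / bitCount false ω n) atTop
        (𝓝 ((α + Real.log (l * (1 - l))) / Real.log l)) := by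
  have hlog := (Real.log_neg hl.1 hl.2).ne
  have h1 : codePt l ω ∈ FJL l α ↔
      Tendsto (fun N => birk (Fmap l) (fun y => Real.log (Fabsd l y)) (bitCount false ω N)
        (codePt l ω) / (bitCount false ω N : ℝ)) atTop (𝓝 α) :=
    (and_iff_right (codePt_mem_Frepeller hl h)).trans (tendsto_comp_bitCount_iff h false
      (f := fun n : ℕ => birk (Fmap l) (fun y => Real.log (Fabsd l y)) n (codePt l ω) / n)).symm
  have hZpos : ∀ᶠ N in atTop, 0 < bitCount false ω N :=
    (tendsto_bitCount_atTop h false).eventually_gt_atTop 0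
  have h2 : ∀ᶠ N in atTop, birk (Fmap l) (fun y => Real.log (Fabsd l y)) (bitCount false ω N)
      (codePt l ω) / (bitCount false ω N : ℝ) =
      -Real.log (l * (1 - l)) + Real.log l * ((idleCount ω N : ℝ) / bitCount false ω N) := by
    filter_upwards [hZpos] with N hN
    have hN' : (bitCount false ω N : ℝ) ≠ 0 := by exact_mod_cast hN.ne'
    have := birk_log_Fabsd hl (isOrbit_codePt (ω := ω) hl)
      (fun N => codePt_mem_Ioo hl (h.tail N)) N
    rw [bitTail_zero] at this
    rw [this]
    field_simp
  rw [h1, tendsto_congr' h2]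
  constructor
  · intro h3
    refine ((h3.add_const (Real.log (l * (1 - l)))).div_const (Real.log l)).congr fun N => ?_
    field_simp
    ring
  · intro h3
    have h4 := (h3.const_mul (Real.log l)).const_add (-Real.log (l * (1 - l)))
    rwa [mul_div_cancel₀ _ hlog, neg_add_cancel_comm_assoc] at h4

lemma FJL_eq_image (hl : l ∈ Ioo (0 : ℝ) 1) {p : ℝ} (hp : p ∈ Ioo (0 : ℝ) 1) :
    FJL l (-Real.log (l * (1 - l)) + p * Real.log l) =
      codePt l '' freqSet ((1 - p) / (2 - p)) := by
  have h2p : (0 : ℝ) < 2 - p := by linarith [hp.2]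
  have hg : (1 - p) / (2 - p) ∈ Ioo (0 : ℝ) 1 :=
    ⟨div_pos (sub_pos.2 hp.2) h2p, (div_lt_one h2p).2 (by linarith)⟩
  have hlog := (Real.log_neg hl.1 hl.2).ne
  have e1 : (-Real.log (l * (1 - l)) + p * Real.log l + Real.log (l * (1 - l))) / Real.log l = p := by
    rw [div_eq_iff hlog]; ring
  ext x
  constructor
  · intro hx
    obtain ⟨ω, hω, rfl⟩ := (Frepeller_eq_image hl).subset hx.1
    rw [codePt_mem_FJL_iff hl hω, e1] at hx
    exact ⟨ω, mem_freqSet_of_tendsto_idleCount hp hω hx, rfl⟩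
  · rintro ⟨ω, hω, rfl⟩
    rw [codePt_mem_FJL_iff hl (bitBalanced_of_mem_freqSet hg hω), e1]
    convert tendsto_idleCount_div hg hω using 2
    have e2 : 1 - 2 * ((1 - p) / (2 - p)) = p / (2 - p) := by field_simp; ring
    have e3 : 1 - (1 - p) / (2 - p) = 1 / (2 - p) := by field_simp; ring
    rw [e2, e3, max_eq_left (div_pos hp.1 h2p).le]
    field_simp

lemma dimH_FJL_top (hl : l ∈ Ioo (1 / 2 : ℝ) 1) : dimH (FJL l (-Real.log (l * (1 - l)))) = 1 := by
  have hl0 : l ∈ Ioo (0 : ℝ) 1 := ⟨by linarith [hl.1], hl.2⟩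
  refine le_antisymm ((dimH_mono (subset_univ _)).trans Real.dimH_univ.le) ?_
  rw [← dimH_codePt_freqSet_self hl0]
  refine dimH_mono ?_
  rintro _ ⟨ω, hω, rfl⟩
  rw [codePt_mem_FJL_iff hl0 (bitBalanced_of_mem_freqSet hl0 hω), neg_add_cancel, zero_div]
  have := tendsto_idleCount_div hl0 hω
  rwa [max_eq_right (by linarith [hl.1]), zero_div] at this

/-- The frequency of `true` in the codes of the points with Lyapunov exponent `α`. -/
def lyapFreq (l α : ℝ) : ℝ := (α + Real.log (1 - l)) / (α + Real.log (1 - l) - Real.log l)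

lemma lyapFreq_mem_Ioo (hl : l ∈ Ioo (0 : ℝ) 1) {α : ℝ} (hα : -Real.log (1 - l) < α) :
    lyapFreq l α ∈ Ioo (0 : ℝ) 1 := by
  have h1 := Real.log_neg hl.1 hl.2
  have h2 : 0 < α + Real.log (1 - l) - Real.log l := by linarith
  exact ⟨div_pos (by linarith) h2, (div_lt_one h2).2 (by linarith)⟩

lemma toReal_dimH_FJL (hl : l ∈ Ioo (0 : ℝ) 1) {α : ℝ}
    (hα : α ∈ Ioo (-Real.log (1 - l)) (-Real.log (l * (1 - l)))) :
    (dimH (FJL l α)).toReal = cylRate (lyapFreq l α) (lyapFreq l α) / cylRate l (lyapFreq l α) := by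
  have h1 := Real.log_neg hl.1 hl.2
  have h2 := Real.log_mul hl.1.ne' (sub_pos.2 hl.2).ne'
  rw [← toReal_dimH_codePt_freqSet hl (lyapFreq_mem_Ioo hl hα.1)]
  obtain ⟨p, hp⟩ : ∃ p, p * Real.log l = α + Real.log (l * (1 - l)) :=
    ⟨_, div_mul_cancel₀ _ h1.ne⟩
  have hα' : α = -Real.log (l * (1 - l)) + p * Real.log l := by linarith
  have hp01 : p ∈ Ioo (0 : ℝ) 1 := by
    obtain ⟨a1, a2⟩ := hα
    constructor <;> nlinarith
  have hfreq : lyapFreq l α = (1 - p) / (2 - p) := by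
    have h3 : (2 - p) ≠ 0 := by linarith [hp01.2]
    have h4 : α + Real.log (1 - l) = -(1 - p) * Real.log l := by linarith
    rw [lyapFreq, h4, show -(1 - p) * Real.log l - Real.log l = -(2 - p) * Real.log l by ring,
      mul_div_mul_right _ _ h1.ne, neg_div_neg_eq]
  rw [hfreq, hα', FJL_eq_image hl hp01]

lemma analyticAt_cylRate_div (hl : l ∈ Ioo (0 : ℝ) 1) {α : ℝ} (hα : -Real.log (1 - l) < α) :
    AnalyticAt ℝ (fun α => cylRate (lyapFreq l α) (lyapFreq l α) / cylRate l (lyapFreq l α)) α := by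
  have hg := lyapFreq_mem_Ioo hl hα
  have h1 := Real.log_neg hl.1 hl.2
  have hA : AnalyticAt ℝ (lyapFreq l) α :=
    (analyticAt_id.add analyticAt_const).div
      ((analyticAt_id.add analyticAt_const).sub analyticAt_const)
      (by change α + Real.log (1 - l) - Real.log l ≠ 0; linarith)
  have hB : AnalyticAt ℝ (fun α => 1 - lyapFreq l α) α := analyticAt_const.sub hA
  refine AnalyticAt.div ?_ ?_ (cylRate_pos hl hg).ne'
  · exact ((hA.mul (hA.log hg.1)).add (hB.mul (hB.log (sub_pos.2 hg.2)))).neg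
  · exact ((hA.mul analyticAt_const).add (hB.mul analyticAt_const)).neg

lemma lyapFreq_top (hl : l ∈ Ioo (0 : ℝ) 1) : lyapFreq l (-Real.log (l * (1 - l))) = 1 / 2 := by
  have h1 := Real.log_neg hl.1 hl.2
  rw [lyapFreq, Real.log_mul hl.1.ne' (sub_pos.2 hl.2).ne', div_eq_iff (by linarith)]
  ring

lemma cylRate_half_div (hl : l ∈ Ioo (0 : ℝ) 1) :
    cylRate (1 / 2) (1 / 2) / cylRate l (1 / 2) = 2 * Real.log 2 / (-Real.log (l * (1 - l))) := by
  have h1 := Real.log_neg hl.1 hl.2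
  have h2 := Real.log_neg (sub_pos.2 hl.2) (by linarith [hl.1])
  have h3 := Real.log_mul hl.1.ne' (sub_pos.2 hl.2).ne'
  have e1 : cylRate (1 / 2) (1 / 2) = Real.log 2 := by
    rw [cylRate, show (1 : ℝ) - 1 / 2 = 1 / 2 by norm_num, one_div, Real.log_inv]; ring
  have e2 : cylRate l (1 / 2) = -Real.log (l * (1 - l)) / 2 := by rw [cylRate, h3]; ring
  rw [e1, e2]
  field_simp

lemma log_ratio_eq (hl : l ∈ Ioo (0 : ℝ) 1) :
    (Real.log 2 / Real.log l) * (Real.log (l / (1 - l)) / (-Real.log (l * (1 - l))) - 1) =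
      2 * Real.log 2 / (-Real.log (l * (1 - l))) := by
  have h1 := Real.log_neg hl.1 hl.2
  have h2 := Real.log_neg (sub_pos.2 hl.2) (by linarith [hl.1])
  rw [Real.log_mul hl.1.ne' (sub_pos.2 hl.2).ne', Real.log_div hl.1.ne' (sub_pos.2 hl.2).ne']
  have h3 : -(Real.log l + Real.log (1 - l)) ≠ 0 := by linarith
  have h4 := h1.ne
  rw [div_sub_one h3, div_mul_div_comm, div_eq_div_iff (mul_ne_zero h4 h3) h3]
  ring

end Dynamics

/-- **Proposition (shape of the Lyapunov spectrum).** For `λ ∈ (1/2, 1)`, with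
`α_m = -log(1-λ)` and `α_M = -log(λ(1-λ))`, the Lyapunov spectrum
`α ↦ dim_H J(α)` is real analytic on `(α_m, α_M)` but discontinuous at `α_M`:
its left limit at `α_M` equals `(log 2/log λ)(log(λ/(1-λ))/(-log(λ(1-λ))) - 1)`,
which is strictly less than `1 = dim_H J(α_M)`. -/
theorem F_lyapunov_spectrum_analytic_and_discontinuous
    (l : ℝ) (hl : l ∈ Set.Ioo (1 / 2 : ℝ) 1) :
    AnalyticOnNhd ℝ (fun α : ℝ => (dimH (FJL l α)).toReal)
      (Set.Ioo (-Real.log (1 - l)) (-Real.log (l * (1 - l)))) ∧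
    Filter.Tendsto (fun α : ℝ => (dimH (FJL l α)).toReal)
      (nhdsWithin (-Real.log (l * (1 - l))) (Set.Iio (-Real.log (l * (1 - l)))))
      (nhds ((Real.log 2 / Real.log l) *
        (Real.log (l / (1 - l)) / (-Real.log (l * (1 - l))) - 1))) ∧
    (Real.log 2 / Real.log l) *
        (Real.log (l / (1 - l)) / (-Real.log (l * (1 - l))) - 1) < 1 ∧
    dimH (FJL l (-Real.log (l * (1 - l)))) = 1 := by
  have hl0 : l ∈ Ioo (0 : ℝ) 1 := ⟨by linarith [hl.1], hl.2⟩
  have hlog := Real.log_neg hl0.1 hl0.2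
  have hmul := Real.log_mul hl0.1.ne' (sub_pos.2 hl0.2).ne'
  have hmM : -Real.log (1 - l) < -Real.log (l * (1 - l)) := by linarith
  refine ⟨fun α hα => ?_, ?_, ?_, dimH_FJL_top hl⟩
  · refine (analyticAt_cylRate_div hl0 hα.1).congr ?_
    filter_upwards [isOpen_Ioo.mem_nhds hα] with β hβ
    exact (toReal_dimH_FJL hl0 hβ).symm
  · have h := (analyticAt_cylRate_div hl0 hmM).continuousAt.tendsto
    rw [lyapFreq_top hl0, cylRate_half_div hl0, ← log_ratio_eq hl0] at h
    refine (h.mono_left nhdsWithin_le_nhds).congr' ?_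
    filter_upwards [Ioo_mem_nhdsLT hmM] with β hβ
    exact (toReal_dimH_FJL hl0 hβ).symm
  · have hprod : 0 < l * (1 - l) := mul_pos hl0.1 (sub_pos.2 hl0.2)
    have h4 : Real.log (l * (1 - l)) < Real.log ((2 ^ 2)⁻¹) :=
      Real.log_lt_log hprod (by nlinarith [sq_pos_of_pos (sub_pos.2 hl.1)])
    rw [Real.log_inv, Real.log_pow, Nat.cast_ofNat] at h4
    rw [log_ratio_eq hl0, div_lt_one (by linarith [Real.log_pos one_lt_two])]
    linarith

end
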